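/- Algebraic completeness for Int2GC: a formula A is provable in Int2GC if and only if v(A) = ⊤ for every valuation v on every H2GC-algebra. -/

import Mathlib

/-- Formulas of the modal language with four unary modalities:
`dia1` = ◆, `box1` = □, `dia2` = ◇, `box2` = ■. -/
inductive Fm : Type
  | var : ℕ → Fm
  | and : Fm → Fm → Fm
  | or  : Fm → Fm → Fm
  | imp : Fm → Fm → Fm
  | neg : Fm → Fm
  | dia1 : Fm → Fm
  | box1 : Fm → Fm
  | dia2 : Fm → Fm
  | box2 : Fm → Fm

/-- Instances of the axiom schemes of intuitionistic propositional logic. -/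
inductive IntAx : Fm → Prop
  | a1 (A B : Fm) : IntAx (.imp A (.imp B A))
  | a2 (A B C : Fm) : IntAx (.imp (.imp A (.imp B C)) (.imp (.imp A B) (.imp A C)))
  | a3 (A B : Fm) : IntAx (.imp (.and A B) A)
  | a4 (A B : Fm) : IntAx (.imp (.and A B) B)
  | a5 (A B : Fm) : IntAx (.imp A (.imp B (.and A B)))
  | a6 (A B : Fm) : IntAx (.imp A (.or A B))
  | a7 (A B : Fm) : IntAx (.imp B (.or A B))
  | a8 (A B C : Fm) : IntAx (.imp (.imp A C) (.imp (.imp B C) (.imp (.or A B) C)))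
  | a9 (A B : Fm) : IntAx (.imp (.imp A B) (.imp (.imp A (.neg B)) (.neg A)))
  | a10 (A B : Fm) : IntAx (.imp (.neg A) (.imp A B))

/-- Provability in the extension of Int2GC by the extra axiom scheme `Ax`:
the smallest set of formulas containing all intuitionistic axiom instances and all
instances of `Ax`, closed under modus ponens and the four Galois-connection rules. -/
inductive Prov (Ax : Fm → Prop) : Fm → Prop
  | intAx {A : Fm} : IntAx A → Prov Ax A
  | extra {A : Fm} : Ax A → Prov Ax A
  | mp {A B : Fm} : Prov Ax (.imp A B) → Prov Ax A → Prov Ax B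
  | gc1 {A B : Fm} : Prov Ax (.imp A (.box1 B)) → Prov Ax (.imp (.dia1 A) B)
  | gc2 {A B : Fm} : Prov Ax (.imp (.dia1 A) B) → Prov Ax (.imp A (.box1 B))
  | gc3 {A B : Fm} : Prov Ax (.imp A (.box2 B)) → Prov Ax (.imp (.dia2 A) B)
  | gc4 {A B : Fm} : Prov Ax (.imp (.dia2 A) B) → Prov Ax (.imp A (.box2 B))

/-- The empty extra axiom scheme: `Prov NoAx` is provability in Int2GC itself. -/
def NoAx : Fm → Prop := fun _ => False

/-- Instances of (FS1): ◆(A → B) → (■A → ◆B). -/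
def FS1Ax (C : Fm) : Prop := ∃ A B : Fm, C = .imp (.dia1 (.imp A B)) (.imp (.box2 A) (.dia1 B))
/-- Instances of (FS2): ◇(A → B) → (□A → ◇B). -/
def FS2Ax (C : Fm) : Prop := ∃ A B : Fm, C = .imp (.dia2 (.imp A B)) (.imp (.box1 A) (.dia2 B))
/-- Instances of (FS3): (◆A → ■B) → ■(A → B). -/
def FS3Ax (C : Fm) : Prop := ∃ A B : Fm, C = .imp (.imp (.dia1 A) (.box2 B)) (.box2 (.imp A B))
/-- Instances of (FS4): (◇A → □B) → □(A → B). -/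
def FS4Ax (C : Fm) : Prop := ∃ A B : Fm, C = .imp (.imp (.dia2 A) (.box1 B)) (.box1 (.imp A B))
/-- The Fischer Servi scheme (FS1)+(FS2); `Prov FSAx` is provability in Int2GC+FS. -/
def FSAx (C : Fm) : Prop := FS1Ax C ∨ FS2Ax C

/-- The extension of a valuation `v` of the propositional variables to all formulas,
over a Heyting algebra equipped with four unary maps interpreting ◆, □, ◇, ■. -/
def Fm.val {H : Type*} [HeytingAlgebra H] (f g f' g' : H → H) (v : ℕ → H) : Fm → H
  | .var n => v n
  | .and A B => A.val f g f' g' v ⊓ B.val f g f' g' v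
  | .or A B => A.val f g f' g' v ⊔ B.val f g f' g' v
  | .imp A B => A.val f g f' g' v ⇨ B.val f g f' g' v
  | .neg A => A.val f g f' g' v ⇨ ⊥
  | .dia1 A => f (A.val f g f' g' v)
  | .box1 A => g (A.val f g f' g' v)
  | .dia2 A => f' (A.val f g f' g' v)
  | .box2 A => g' (A.val f g f' g' v)

namespace Prov

variable {Ax : Fm → Prop} {A B C D : Fm}

/-- Weakening of a theorem by an arbitrary antecedent. -/
theorem weaken (h : Prov Ax B) : Prov Ax (.imp A B) := .mp (.intAx (.a1 _ _)) h

/-- Modus ponens under an antecedent. -/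
theorem imp_mp (h : Prov Ax (.imp A (.imp B C))) (h' : Prov Ax (.imp A B)) :
    Prov Ax (.imp A C) :=
  .mp (.mp (.intAx (.a2 _ _ _)) h) h'

theorem imp_refl (A : Fm) : Prov Ax (.imp A A) :=
  imp_mp (B := .imp A A) (.intAx (.a1 _ _)) (.intAx (.a1 _ _))

theorem imp_trans (h : Prov Ax (.imp A B)) (h' : Prov Ax (.imp B C)) : Prov Ax (.imp A C) :=
  imp_mp (weaken h') h

theorem and_left (A B : Fm) : Prov Ax (.imp (.and A B) A) := .intAx (.a3 _ _)

theorem and_right (A B : Fm) : Prov Ax (.imp (.and A B) B) := .intAx (.a4 _ _)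

theorem imp_and (h : Prov Ax (.imp A B)) (h' : Prov Ax (.imp A C)) :
    Prov Ax (.imp A (.and B C)) :=
  imp_mp (imp_trans h (.intAx (.a5 _ _))) h'

theorem or_inl (A B : Fm) : Prov Ax (.imp A (.or A B)) := .intAx (.a6 _ _)

theorem or_inr (A B : Fm) : Prov Ax (.imp B (.or A B)) := .intAx (.a7 _ _)

theorem or_imp (h : Prov Ax (.imp A C)) (h' : Prov Ax (.imp B C)) :
    Prov Ax (.imp (.or A B) C) :=
  .mp (.mp (.intAx (.a8 _ _ _)) h) h'

theorem imp_imp_iff : Prov Ax (.imp A (.imp B C)) ↔ Prov Ax (.imp (.and A B) C) := by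
  refine ⟨fun h => imp_mp (imp_trans (and_left _ _) h) (and_right _ _), fun h => ?_⟩
  have h₁ : Prov Ax (.imp A (.imp (.imp B (.and A B)) (.imp B C))) :=
    weaken (.mp (.intAx (.a2 _ _ _)) (weaken h))
  exact imp_mp h₁ (.intAx (.a5 _ _))

theorem and_neg_imp (A B : Fm) : Prov Ax (.imp (.and A (.neg A)) B) :=
  imp_mp (imp_trans (and_right _ _) (.intAx (.a10 _ _))) (and_left _ _)

theorem neg_imp (A B : Fm) : Prov Ax (.imp (.neg A) (.imp A B)) := .intAx (.a10 _ _)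

/-- A formula implying a contradiction is refuted. -/
theorem imp_contra_imp_neg (A B : Fm) :
    Prov Ax (.imp (.imp A (.and B (.neg B))) (.neg A)) := by
  have h (C : Fm) :
      Prov Ax (.imp (.imp A (.and B (.neg B))) (.imp A C)) :=
    imp_imp_iff.2 (imp_trans (imp_imp_iff.1 (imp_refl _)) (and_neg_imp _ _))
  exact imp_mp (imp_trans (h B) (.intAx (.a9 _ _))) (h (.neg B))

theorem and_mono (h : Prov Ax (.imp A B)) (h' : Prov Ax (.imp C D)) :
    Prov Ax (.imp (.and A C) (.and B D)) :=
  imp_and (imp_trans (and_left _ _) h) (imp_trans (and_right _ _) h')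

theorem or_mono (h : Prov Ax (.imp A B)) (h' : Prov Ax (.imp C D)) :
    Prov Ax (.imp (.or A C) (.or B D)) :=
  or_imp (imp_trans h (or_inl _ _)) (imp_trans h' (or_inr _ _))

theorem imp_mono (h : Prov Ax (.imp B A)) (h' : Prov Ax (.imp C D)) :
    Prov Ax (.imp (.imp A C) (.imp B D)) :=
  imp_imp_iff.2 (imp_trans (and_mono (imp_refl _) h)
    (imp_trans (imp_imp_iff.1 (imp_refl _)) h'))

theorem dia1_mono (h : Prov Ax (.imp A B)) : Prov Ax (.imp (.dia1 A) (.dia1 B)) :=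
  .gc1 (imp_trans h (.gc2 (imp_refl _)))

theorem box1_mono (h : Prov Ax (.imp A B)) : Prov Ax (.imp (.box1 A) (.box1 B)) :=
  .gc2 (imp_trans (.gc1 (imp_refl _)) h)

theorem dia2_mono (h : Prov Ax (.imp A B)) : Prov Ax (.imp (.dia2 A) (.dia2 B)) :=
  .gc3 (imp_trans h (.gc4 (imp_refl _)))

theorem box2_mono (h : Prov Ax (.imp A B)) : Prov Ax (.imp (.box2 A) (.box2 B)) :=
  .gc4 (imp_trans (.gc3 (imp_refl _)) h)

/-- Soundness: if the extra axioms are valid under a valuation, so is every theorem. -/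
theorem val_eq_top {H : Type*} [HeytingAlgebra H] {f g f' g' : H → H}
    (hfg : ∀ a b : H, f a ≤ b ↔ a ≤ g b) (hfg' : ∀ a b : H, f' a ≤ b ↔ a ≤ g' b)
    (v : ℕ → H) (hAx : ∀ A, Ax A → A.val f g f' g' v = ⊤) (h : Prov Ax A) :
    A.val f g f' g' v = ⊤ := by
  induction h with
  | intAx h =>
    cases h with
    | a1 A B => simp [Fm.val]
    | a2 A B C =>
      simp only [Fm.val, himp_eq_top_iff, le_himp_iff]
      generalize A.val f g f' g' v = a, B.val f g f' g' v = b, C.val f g f' g' v = c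
      have h₁ : (a ⇨ b ⇨ c) ⊓ (a ⇨ b) ⊓ a ≤ b := by
        rw [← le_himp_iff]; exact inf_le_right
      have h₂ : (a ⇨ b ⇨ c) ⊓ (a ⇨ b) ⊓ a ≤ b ⇨ c := by
        rw [← le_himp_iff]; exact inf_le_left
      exact (le_inf h₂ h₁).trans himp_inf_le
    | a3 A B => simp [Fm.val]
    | a4 A B => simp [Fm.val]
    | a5 A B => simp [Fm.val]
    | a6 A B => simp [Fm.val]
    | a7 A B => simp [Fm.val]
    | a8 A B C =>
      simp only [Fm.val, himp_eq_top_iff, le_himp_iff, inf_sup_left]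
      exact sup_le ((inf_le_inf_right _ inf_le_left).trans himp_inf_le)
        ((inf_le_inf_right _ inf_le_right).trans himp_inf_le)
    | a9 A B =>
      simp only [Fm.val, himp_eq_top_iff, le_himp_iff]
      generalize A.val f g f' g' v = a, B.val f g f' g' v = b
      have h₁ : (a ⇨ b) ⊓ (a ⇨ b ⇨ ⊥) ⊓ a ≤ b := by
        rw [← le_himp_iff]; exact inf_le_left
      have h₂ : (a ⇨ b) ⊓ (a ⇨ b ⇨ ⊥) ⊓ a ≤ b ⇨ ⊥ := by
        rw [← le_himp_iff]; exact inf_le_right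
      exact (le_inf h₂ h₁).trans himp_inf_le
    | a10 A B =>
      simp only [Fm.val, himp_eq_top_iff]
      exact himp_le_himp_left bot_le
  | extra h => exact hAx _ h
  | mp _ _ ih ih' => simpa [Fm.val, ih'] using ih
  | gc1 _ ih => simpa [Fm.val, hfg] using ih
  | gc2 _ ih => simpa [Fm.val, hfg] using ih
  | gc3 _ ih => simpa [Fm.val, hfg'] using ih
  | gc4 _ ih => simpa [Fm.val, hfg'] using ih

end Prov

/-- Provable equivalence of formulas. -/
def provEquiv (Ax : Fm → Prop) : Setoid Fm where
  r A B := Prov Ax (.imp A B) ∧ Prov Ax (.imp B A)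
  iseqv :=
    { refl := fun A => ⟨Prov.imp_refl A, Prov.imp_refl A⟩
      symm := fun h => ⟨h.2, h.1⟩
      trans := fun h h' => ⟨h.1.imp_trans h'.1, h'.2.imp_trans h.2⟩ }

/-- The Lindenbaum–Tarski algebra of the extension of Int2GC by `Ax`. -/
def Lindenbaum (Ax : Fm → Prop) : Type := Quotient (provEquiv Ax)

namespace Lindenbaum

variable {Ax : Fm → Prop}

/-- The class of a formula in the Lindenbaum–Tarski algebra. -/
def mk (A : Fm) : Lindenbaum Ax := Quotient.mk (provEquiv Ax) A

theorem ind {p : Lindenbaum Ax → Prop} (h : ∀ A, p (mk A)) (a : Lindenbaum Ax) : p a :=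
  Quotient.ind h a

/-- The operation on classes induced by a monotone unary connective. -/
def map (c : Fm → Fm) (hc : ∀ {A B}, Prov Ax (.imp A B) → Prov Ax (.imp (c A) (c B))) :
    Lindenbaum Ax → Lindenbaum Ax :=
  Quotient.map c fun _ _ h => ⟨hc h.1, hc h.2⟩

instance : PartialOrder (Lindenbaum Ax) where
  le := Quotient.lift₂ (fun A B => Prov Ax (.imp A B)) fun _ _ _ _ h h' =>
    propext ⟨fun k => (h.2.imp_trans k).imp_trans h'.1, fun k => (h.1.imp_trans k).imp_trans h'.2⟩
  le_refl := ind Prov.imp_refl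
  le_trans := ind fun _ => ind fun _ => ind fun _ => Prov.imp_trans
  le_antisymm := ind fun _ => ind fun _ h h' => Quotient.sound ⟨h, h'⟩

theorem mk_le_mk {A B : Fm} : (mk A : Lindenbaum Ax) ≤ mk B ↔ Prov Ax (.imp A B) := Iff.rfl

instance : HeytingAlgebra (Lindenbaum Ax) where
  sup := Quotient.map₂ Fm.or fun _ _ h _ _ h' => ⟨h.1.or_mono h'.1, h.2.or_mono h'.2⟩
  inf := Quotient.map₂ Fm.and fun _ _ h _ _ h' => ⟨h.1.and_mono h'.1, h.2.and_mono h'.2⟩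
  himp := Quotient.map₂ Fm.imp fun _ _ h _ _ h' => ⟨h.2.imp_mono h'.1, h.1.imp_mono h'.2⟩
  compl := Quotient.map Fm.neg fun _ _ h =>
    have key {A B : Fm} (h : Prov Ax (.imp A B)) : Prov Ax (.imp (.neg B) (.neg A)) :=
      ((Prov.neg_imp B _).imp_trans (h.imp_mono (Prov.imp_refl _))).imp_trans
        (Prov.imp_contra_imp_neg A A)
    ⟨key h.2, key h.1⟩
  top := mk (.imp (.var 0) (.var 0))
  bot := mk (.and (.var 0) (.neg (.var 0)))
  le_sup_left := ind fun _ => ind fun _ => Prov.or_inl _ _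
  le_sup_right := ind fun _ => ind fun _ => Prov.or_inr _ _
  sup_le := ind fun _ => ind fun _ => ind fun _ => Prov.or_imp
  inf_le_left := ind fun _ => ind fun _ => Prov.and_left _ _
  inf_le_right := ind fun _ => ind fun _ => Prov.and_right _ _
  le_inf := ind fun _ => ind fun _ => ind fun _ => Prov.imp_and
  le_top := ind fun _ => Prov.weaken (Prov.imp_refl _)
  bot_le := ind fun _ => Prov.and_neg_imp _ _
  le_himp_iff := ind fun _ => ind fun _ => ind fun _ => Prov.imp_imp_iff
  himp_bot := ind fun _ =>
    Quotient.sound ⟨Prov.imp_contra_imp_neg _ _, Prov.neg_imp _ _⟩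

theorem mk_eq_top_iff {A : Fm} : (mk A : Lindenbaum Ax) = ⊤ ↔ Prov Ax A := by
  rw [← top_le_iff]
  exact ⟨fun h => Prov.mp h (Prov.imp_refl _), Prov.weaken⟩

/-- The canonical valuation sends each formula to its class. -/
theorem val_eq_mk (A : Fm) :
    A.val (map Fm.dia1 Prov.dia1_mono) (map Fm.box1 Prov.box1_mono)
      (map Fm.dia2 Prov.dia2_mono) (map Fm.box2 Prov.box2_mono)
      (fun n => (mk (.var n) : Lindenbaum Ax)) = mk A := by
  induction A with
  | var n => rfl
  | neg A ih =>
    rw [Fm.val, ih, himp_bot]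
    rfl
  | and A B ih ih' | or A B ih ih' | imp A B ih ih' =>
    rw [Fm.val, ih, ih']
    rfl
  | dia1 A ih | box1 A ih | dia2 A ih | box2 A ih =>
    rw [Fm.val, ih]
    rfl

end Lindenbaum

/-- Algebraic completeness for Int2GC: a formula is provable in Int2GC iff it is
valid (takes value ⊤ under every valuation) in every H2GC-algebra. -/
theorem int2gc_algebraic_completeness (A : Fm) :
    Prov NoAx A ↔
      ∀ (H : Type) [HeytingAlgebra H] (f g f' g' : H → H),
        (∀ a b : H, f a ≤ b ↔ a ≤ g b) → (∀ a b : H, f' a ≤ b ↔ a ≤ g' b) →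
        ∀ v : ℕ → H, A.val f g f' g' v = ⊤ := by
  refine ⟨fun h H _ f g f' g' hfg hfg' v => h.val_eq_top hfg hfg' v fun _ => False.elim,
    fun h => ?_⟩
  rw [← Lindenbaum.mk_eq_top_iff, ← Lindenbaum.val_eq_mk]
  refine h _ _ _ _ _ ?_ ?_ _
  · exact Lindenbaum.ind fun _ => Lindenbaum.ind fun _ => ⟨Prov.gc2, Prov.gc1⟩
  · exact Lindenbaum.ind fun _ => Lindenbaum.ind fun _ => ⟨Prov.gc4, Prov.gc3⟩
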